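/- arXiv:1404.6632 — 2 statements merged into one kernel-verified Lean document; each statement's English description precedes it below -/
import Mathlib

section
/- Let M = (Q, Σ, δ, q₀, F) be a minimal DFA with |Q| = n > 1. If every function f : Q → Q is induced by some nonempty word (i.e., T(M) is the full transformation monoid on Q), then for every subset S ⊆ Q the atom A_S has state complexity exactly Ψ(n, |S|). -/
/-- `Psi n s` of Brzozowski–Tamm: the tight upper bound on the state complexity
of an atom `A_S` with `|S| = s` of a language of state complexity `n`. -/
def Psi (n s : ℕ) : ℕ :=
  if s = 0 ∨ s = n then 2 ^ n - 1
  else 1 + ∑ k ∈ Finset.Icc 1 s, ∑ l ∈ Finset.Icc 1 (n - s),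
    Nat.choose n k * Nat.choose (n - k) l

/-- The Myhill–Nerode right congruence of a language `K`. -/
def rightCong {A : Type*} (K : Set (List A)) : Setoid (List A) where
  r x y := ∀ z, x ++ z ∈ K ↔ y ++ z ∈ K
  iseqv := ⟨fun _ _ => Iff.rfl, fun h z => (h z).symm, fun h1 h2 z => (h1 z).trans (h2 z)⟩

/-- The state complexity of a language: the number of classes of its
Myhill–Nerode right congruence. -/
noncomputable def stateComplexity {A : Type*} (K : Set (List A)) : ℕ :=
  Nat.card (Quotient (rightCong K))

/-- The atom `A_S` of the language of the DFA `M`. -/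
def atom {A Q : Type*} (M : DFA A Q) (S : Set Q) : Set (List A) :=
  {w | ∀ q, M.evalFrom q w ∈ M.accept ↔ q ∈ S}

/-- A DFA is minimal iff all its states are reachable and pairwise distinguishable. -/
def IsMinimal {A Q : Type*} (M : DFA A Q) : Prop :=
  (∀ q, ∃ w : List A, M.evalFrom M.start w = q) ∧
  ∀ p q : Q, p ≠ q → ∃ w : List A,
    ¬(M.evalFrom p w ∈ M.accept ↔ M.evalFrom q w ∈ M.accept)

section Aux
open Finset

variable {Q : Type*} [Fintype Q] [DecidableEq Q]

/-- The invariant of a transformation that determines its Myhill–Nerode class. -/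
def inv3 (S : Finset Q) (f : Q → Q) : Option (Finset Q × Finset Q) :=
  if Disjoint (S.image f) (Sᶜ.image f) then some (S.image f, Sᶜ.image f) else none

theorem pre_iff (S : Finset Q) (f : Q → Q) (T : Finset Q) :
    (∀ q, f q ∈ T ↔ q ∈ S) ↔ S.image f ⊆ T ∧ Sᶜ.image f ⊆ Tᶜ := by
  simp only [Finset.image_subset_iff, Finset.mem_compl]
  constructor
  · intro h
    exact ⟨fun q hq => (h q).2 hq, fun q hq hh => hq ((h q).1 hh)⟩
  · rintro ⟨h1, h2⟩ q
    exact ⟨fun h => by by_contra hq; exact h2 q hq h, h1 q⟩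

theorem inv3_le (S : Finset Q) (f g : Q → Q)
    (h : ∀ T : Finset Q, (∀ q, f q ∈ T ↔ q ∈ S) → (∀ q, g q ∈ T ↔ q ∈ S))
    (hd : Disjoint (S.image f) (Sᶜ.image f)) :
    S.image g ⊆ S.image f ∧ Sᶜ.image g ⊆ Sᶜ.image f := by
  simp only [pre_iff] at h
  constructor
  · exact (h (S.image f) ⟨subset_rfl, by
      rw [Finset.subset_compl_iff_disjoint_right]; exact hd.symm⟩).1
  · have := (h (Sᶜ.image f)ᶜ ⟨by
      rw [Finset.subset_compl_iff_disjoint_right]; exact hd, by simp⟩).2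
    simpa using this

theorem not_pre (S : Finset Q) (f : Q → Q) (T : Finset Q)
    (hd : ¬ Disjoint (S.image f) (Sᶜ.image f)) : ¬ (∀ q, f q ∈ T ↔ q ∈ S) := by
  rw [pre_iff]
  rintro ⟨h1, h2⟩
  exact hd (Disjoint.mono h1 h2 disjoint_compl_right)

theorem inv3_iff (S : Finset Q) (f g : Q → Q) :
    (∀ T : Finset Q, (∀ q, f q ∈ T ↔ q ∈ S) ↔ (∀ q, g q ∈ T ↔ q ∈ S)) ↔
      inv3 S f = inv3 S g := by
  constructor
  · intro h
    by_cases hf : Disjoint (S.image f) (Sᶜ.image f)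
    · obtain ⟨a, b⟩ := inv3_le S f g (fun T => (h T).1) hf
      have hg := Disjoint.mono a b hf
      obtain ⟨c, d⟩ := inv3_le S g f (fun T => (h T).2) hg
      simp only [inv3, hf, hg, if_true]
      rw [subset_antisymm a c, subset_antisymm b d]
    · have hg : ¬ Disjoint (S.image g) (Sᶜ.image g) := by
        intro hg
        obtain ⟨c, d⟩ := inv3_le S g f (fun T => (h T).2) hg
        exact hf (Disjoint.mono c d hg)
      simp [inv3, hf, hg]
  · intro h T
    by_cases hf : Disjoint (S.image f) (Sᶜ.image f) <;>
    by_cases hg : Disjoint (S.image g) (Sᶜ.image g)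
    · simp only [inv3, hf, hg, if_true, Option.some.injEq, Prod.mk.injEq] at h
      rw [pre_iff, pre_iff, h.1, h.2]
    · simp [inv3, hf, hg] at h
    · simp [inv3, hf, hg] at h
    · exact iff_of_false (not_pre S f T hf) (not_pre S g T hg)

theorem exists_image (S X : Finset Q) (hX : X = ∅ ↔ S = ∅) (hc : X.card ≤ S.card) :
    ∃ g : Q → Q, S.image g = X := by
  by_cases hS : S = ∅
  · exact ⟨id, by simp [hS, hX.2 hS]⟩
  have hne : X.Nonempty := Finset.nonempty_iff_ne_empty.2 (fun h => hS (hX.1 h))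
  obtain ⟨x0, hx0⟩ := hne
  haveI : Nonempty X := ⟨⟨x0, hx0⟩⟩
  obtain ⟨e⟩ : Nonempty (X ↪ S) :=
    Function.Embedding.nonempty_of_card_le (by simpa using hc)
  refine ⟨fun q => if h : q ∈ S then (Function.invFun e ⟨q, h⟩ : X) else q, ?_⟩
  ext y
  simp only [Finset.mem_image]
  constructor
  · rintro ⟨q, hq, rfl⟩
    simp [hq]
  · intro hy
    refine ⟨e ⟨y, hy⟩, (e ⟨y, hy⟩).2, ?_⟩
    have := Function.leftInverse_invFun e.injective ⟨y, hy⟩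
    simp [this]

/-- Admissible pairs. -/
def pairs3 (S : Finset Q) : Finset (Finset Q × Finset Q) :=
  univ.filter fun p => Disjoint p.1 p.2 ∧ p.1.card ≤ S.card ∧ p.2.card ≤ Sᶜ.card ∧
    (p.1 = ∅ ↔ S = ∅) ∧ (p.2 = ∅ ↔ Sᶜ = ∅)

theorem some_mem_range (S : Finset Q) (p : Finset Q × Finset Q) :
    (∃ f, inv3 S f = some p) ↔ p ∈ pairs3 S := by
  obtain ⟨X, Y⟩ := p
  simp only [pairs3, mem_filter, mem_univ, true_and]
  constructor
  · rintro ⟨f, hf⟩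
    unfold inv3 at hf
    split_ifs at hf with hd
    simp only [Option.some.injEq, Prod.mk.injEq] at hf
    obtain ⟨rfl, rfl⟩ := hf
    exact ⟨hd, card_image_le, card_image_le, by simp, by simp only [Finset.image_eq_empty]⟩
  · rintro ⟨hd, h1, h2, h3, h4⟩
    obtain ⟨a, ha⟩ := exists_image S X h3 h1
    obtain ⟨b, hb⟩ := exists_image Sᶜ Y h4 h2
    have e1 : S.image (fun q => if q ∈ S then a q else b q) = X := by
      rw [← ha]; exact image_congr (fun q hq => by simp at hq; simp [hq])
    have e2 : Sᶜ.image (fun q => if q ∈ S then a q else b q) = Y := by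
      rw [← hb]; exact image_congr (fun q hq => by simp at hq; simp [hq])
    refine ⟨fun q => if q ∈ S then a q else b q, ?_⟩
    simp only [inv3, e1, e2, hd, if_true]

theorem none_mem_range (S : Finset Q) :
    (∃ f, inv3 S f = none) ↔ S ≠ ∅ ∧ Sᶜ ≠ ∅ := by
  constructor
  · rintro ⟨f, hf⟩
    constructor
    · intro h
      simp [inv3, h] at hf
    · intro h
      simp [inv3, h] at hf
  · rintro ⟨h1, h2⟩
    obtain ⟨a, ha⟩ := nonempty_iff_ne_empty.2 h1
    obtain ⟨b, hb⟩ := nonempty_iff_ne_empty.2 h2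
    refine ⟨fun _ => a, ?_⟩
    rw [inv3, if_neg]
    rw [Finset.not_disjoint_iff]
    exact ⟨a, mem_image_of_mem _ ha, mem_image.2 ⟨b, hb, rfl⟩⟩

theorem fiber_card (k l : ℕ) :
    (univ.filter fun p : Finset Q × Finset Q =>
      Disjoint p.1 p.2 ∧ p.1.card = k ∧ p.2.card = l).card =
    Nat.choose (Fintype.card Q) k * Nat.choose (Fintype.card Q - k) l := by
  have : ((powersetCard k (univ : Finset Q)).sigma fun X => powersetCard l Xᶜ).card =
      Nat.choose (Fintype.card Q) k * Nat.choose (Fintype.card Q - k) l := by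
    rw [card_sigma, sum_const_nat (m := Nat.choose (Fintype.card Q - k) l)]
    · simp [card_univ]
    · intro X hX
      rw [card_powersetCard, card_compl, (mem_powersetCard.1 hX).2]
  rw [← this]
  refine card_nbij' (fun p => ⟨p.1, p.2⟩) (fun p => (p.1, p.2)) ?_ ?_ ?_ ?_
  · rintro ⟨X, Y⟩ h
    simp at h ⊢
    exact ⟨h.2.1, 
      ⟨Finset.subset_compl_iff_disjoint_right.2 h.1.symm, h.2.2⟩⟩
  · rintro ⟨X, Y⟩ h
    simp [mem_powersetCard, Finset.subset_compl_iff_disjoint_right] at h ⊢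
    exact ⟨h.2.1.symm, h.1, h.2.2⟩
  · rintro ⟨X, Y⟩ h; rfl
  · rintro ⟨X, Y⟩ h; rfl

theorem pairs_card_mid (S : Finset Q) (h1 : S ≠ ∅) (h2 : Sᶜ ≠ ∅) :
    (pairs3 S).card = ∑ k ∈ Finset.Icc 1 S.card,
      ∑ l ∈ Finset.Icc 1 (Fintype.card Q - S.card),
        Nat.choose (Fintype.card Q) k * Nat.choose (Fintype.card Q - k) l := by
  rw [← sum_product' (Icc 1 S.card) (Icc 1 (Fintype.card Q - S.card))
    (fun k l => Nat.choose (Fintype.card Q) k * Nat.choose (Fintype.card Q - k) l)]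
  have key : ∀ p : Finset Q × Finset Q, p ∈ pairs3 S ↔
      Disjoint p.1 p.2 ∧ (p.1.card, p.2.card) ∈
        Icc 1 S.card ×ˢ Icc 1 (Fintype.card Q - S.card) := by
    intro p
    simp only [pairs3, mem_filter, mem_univ, true_and, h1, h2, iff_false, mem_product, mem_Icc,
      Nat.one_le_iff_ne_zero, ne_eq, card_eq_zero, card_compl]
    tauto
  rw [card_eq_sum_card_fiberwise (f := fun p : Finset Q × Finset Q => (p.1.card, p.2.card))
    (t := Icc 1 S.card ×ˢ Icc 1 (Fintype.card Q - S.card))]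
  · refine sum_congr rfl ?_
    rintro ⟨k, l⟩ hkl
    rw [← fiber_card k l]
    congr 1
    ext p
    simp only [mem_filter, key, mem_univ, true_and, Prod.mk.injEq]
    constructor
    · rintro ⟨⟨a, b⟩, c⟩; exact ⟨a, c⟩
    · rintro ⟨a, c, d⟩; exact ⟨⟨a, by rw [c, d]; exact hkl⟩, c, d⟩
  · intro p hp
    exact ((key p).1 hp).2

theorem pairs_card_empty [Nonempty Q] : (pairs3 (∅ : Finset Q)).card = 2 ^ Fintype.card Q - 1 := by
  have : pairs3 (∅ : Finset Q) = (univ.erase ∅).image (fun Y => (∅, Y)) := by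
    ext ⟨X, Y⟩
    simp [pairs3, card_le_univ]
    have hu : (univ : Finset Q) ≠ ∅ := univ_nonempty.ne_empty
    simp only [hu, iff_false]
    grind [disjoint_empty_left, disjoint_empty_right]
  rw [this, card_image_of_injective _ (fun a b h => by simpa using h), card_erase_of_mem (mem_univ _)]
  simp [card_univ]

theorem pairs_card_univ [Nonempty Q] :
    (pairs3 (univ : Finset Q)).card = 2 ^ Fintype.card Q - 1 := by
  have : pairs3 (univ : Finset Q) = (univ.erase ∅).image (fun Y => (Y, ∅)) := by
    ext ⟨X, Y⟩
    simp [pairs3, card_le_univ]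
    have hu : (univ : Finset Q) ≠ ∅ := univ_nonempty.ne_empty
    simp only [hu, iff_false]
    grind [disjoint_empty_left, disjoint_empty_right]
  rw [this, card_image_of_injective _ (fun a b h => by simpa using h), card_erase_of_mem (mem_univ _)]
  simp [card_univ]

theorem range_card [Nonempty Q] (S : Finset Q) :
    Nat.card (Set.range (inv3 S)) = Psi (Fintype.card Q) S.card := by
  by_cases h : S ≠ ∅ ∧ Sᶜ ≠ ∅
  · have : Set.range (inv3 S) = ((pairs3 S).insertNone : Finset _) := by
      ext o
      cases o with
      | none => simpa using (none_mem_range S).2 h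
      | some p => simpa using some_mem_range S p
    rw [this, Nat.card_coe_set_eq, Set.ncard_coe_finset, card_insertNone,
      pairs_card_mid S h.1 h.2, Psi, if_neg, add_comm]
    rintro (h0 | h0)
    · exact h.1 (card_eq_zero.1 h0)
    · exact h.2 (by rw [(card_eq_iff_eq_univ S).1 h0]; simp)
  · have : Set.range (inv3 S) = ((pairs3 S).map Function.Embedding.some : Finset _) := by
      ext o
      cases o with
      | none => simpa using fun f hf => h ((none_mem_range S).1 ⟨f, hf⟩)
      | some p => simpa using some_mem_range S p
    rw [this, Nat.card_coe_set_eq, Set.ncard_coe_finset, card_map]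
    have h' : S = ∅ ∨ S = univ := by
      by_contra hc
      push Not at hc
      exact h ⟨by grind, by simpa using hc.2⟩
    rcases h' with rfl | rfl
    · rw [pairs_card_empty, Psi, if_pos (by simp)]
    · rw [pairs_card_univ, Psi, if_pos (by simp [card_univ])]

end Aux

/-- if the transformation semigroup of a minimal DFA with `n > 1`
states is the full transformation monoid, then every atom `A_S` has state
complexity exactly `Ψ(n, |S|)`. -/
theorem statement3 {A Q : Type*} [Fintype A] [Fintype Q] (M : DFA A Q)
    (n : ℕ) (hQ : Fintype.card Q = n) (hn : 1 < n) (hmin : IsMinimal M)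
    (hfull : ∀ f : Q → Q, ∃ w : List A, w ≠ [] ∧ (fun q => M.evalFrom q w) = f) :
    ∀ S : Set Q, stateComplexity (atom M S) = Psi n S.ncard := by
  classical
  intro S0
  obtain ⟨S, rfl⟩ : ∃ S : Finset Q, (S : Set Q) = S0 := ⟨S0.toFinset, by simp⟩
  subst hQ
  haveI : Nonempty Q := ⟨M.start⟩
  rw [Set.ncard_coe_finset, ← range_card]
  obtain ⟨p, q, hpq⟩ := Fintype.one_lt_card_iff.1 hn
  obtain ⟨a, b, ha, hb⟩ : ∃ a b, a ∈ M.accept ∧ b ∉ M.accept := by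
    obtain ⟨w, hw⟩ := hmin.2 p q hpq
    by_cases h : M.evalFrom p w ∈ M.accept
    · exact ⟨_, M.evalFrom q w, h, by tauto⟩
    · exact ⟨M.evalFrom q w, _, by tauto, h⟩
  have hT : ∀ T : Finset Q, ∃ z : List A, ∀ q, M.evalFrom q z ∈ M.accept ↔ q ∈ T := by
    intro T
    obtain ⟨z, -, hz⟩ := hfull (fun q => if q ∈ T then a else b)
    refine ⟨z, fun q => ?_⟩
    rw [congrFun hz q]
    by_cases h : q ∈ T <;> simp [h, ha, hb]
  let φ : List A → Option (Finset Q × Finset Q) := fun w => inv3 S (fun q => M.evalFrom q w)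
  have hker : rightCong (atom M (S : Set Q)) = Setoid.ker φ := by
    ext x y
    change (∀ z, x ++ z ∈ atom M (S : Set Q) ↔ y ++ z ∈ atom M (S : Set Q)) ↔ φ x = φ y
    rw [← inv3_iff]
    simp only [atom, Set.mem_setOf_eq, DFA.evalFrom_of_append, Finset.mem_coe]
    constructor
    · intro h T
      obtain ⟨z, hz⟩ := hT T
      simpa only [hz] using h z
    · intro h z
      simpa using h (Finset.univ.filter fun q => M.evalFrom q z ∈ M.accept)
  have hr : Set.range φ = Set.range (inv3 S) := by
    ext o
    constructor
    · rintro ⟨w, rfl⟩; exact ⟨_, rfl⟩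
    · rintro ⟨f, rfl⟩
      obtain ⟨w, -, hw⟩ := hfull f
      exact ⟨w, by simp only [φ, hw]⟩
  rw [stateComplexity, hker, ← hr]
  exact Nat.card_congr (Setoid.quotientKerEquivRange φ)
end

section
/- Let M = (Q, Σ, δ, q₀, F) be a minimal DFA with |Q| = n ≥ 3. Suppose that for every S ⊆ Q, if the atom A_S is nonempty then A_S has state complexity Ψ(n, |S|). Then: (i) P(M) is set-transitive; (ii) there is a nonempty word inducing a transformation of Q of rank n − 1; and (iii) A_T is nonempty for every T ⊆ Q. -/
open Classical in
/-- Admissible pairs. -/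
noncomputable def dPairs (Q : Type*) [Fintype Q] (s t : ℕ) : Finset (Finset Q × Finset Q) :=
  Finset.univ.filter fun p => Disjoint p.1 p.2 ∧ (1 ≤ p.1.card ∧ p.1.card ≤ s) ∧
    (1 ≤ p.2.card ∧ p.2.card ≤ t)

/-- Language attached to a pair. -/
def bLang {A Q : Type*} (M : DFA A Q) (p : Finset Q × Finset Q) : Set (List A) :=
  {z | (∀ q ∈ p.1, M.evalFrom q z ∈ M.accept) ∧ ∀ q ∈ p.2, M.evalFrom q z ∉ M.accept}

lemma dPairs_card_le (Q : Type*) [Fintype Q] (s t : ℕ) :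
    (dPairs Q s t).card ≤ ∑ k ∈ Finset.Icc 1 s, ∑ l ∈ Finset.Icc 1 t,
      Nat.choose (Fintype.card Q) k * Nat.choose (Fintype.card Q - k) l := by
  classical
  have hsub : dPairs Q s t ⊆ (Finset.Icc 1 s).biUnion fun k => (Finset.Icc 1 t).biUnion fun l =>
      (Finset.powersetCard k (Finset.univ : Finset Q)).biUnion fun X =>
        (Finset.powersetCard l Xᶜ).image fun Y => (X, Y) := by
    rintro ⟨X, Y⟩ h
    simp only [dPairs, Finset.mem_filter, Finset.mem_univ, true_and] at h
    obtain ⟨hd, h1, h2⟩ := h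
    simp only [Finset.mem_biUnion, Finset.mem_image, Finset.mem_powersetCard, Finset.mem_Icc]
    exact ⟨X.card, h1, Y.card, h2, X, ⟨Finset.subset_univ _, rfl⟩, Y,
      ⟨Finset.subset_compl_iff_disjoint_left.2 hd, rfl⟩, rfl⟩
  refine (Finset.card_le_card hsub).trans ?_
  refine Finset.card_biUnion_le.trans (Finset.sum_le_sum fun k _ => ?_)
  refine Finset.card_biUnion_le.trans (Finset.sum_le_sum fun l _ => ?_)
  refine (Finset.card_biUnion_le_card_mul _ _ (Nat.choose (Fintype.card Q - k) l) ?_).trans ?_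
  · intro X hX
    refine Finset.card_image_le.trans ?_
    rw [Finset.card_powersetCard, Finset.card_compl, (Finset.mem_powersetCard.1 hX).2]
  · rw [Finset.card_powersetCard, Finset.card_univ]

open Classical in
lemma key {A Q : Type*} [Fintype Q] (M : DFA A Q) (S : Finset Q)
    (h1 : 1 ≤ S.card) (h2 : S.card + 1 ≤ Fintype.card Q)
    (hsc : stateComplexity (atom M (S : Set Q)) = Psi (Fintype.card Q) S.card) :
    (∀ p ∈ dPairs Q S.card (Fintype.card Q - S.card),
      (∃ x : List A, p = (S.image (fun q => M.evalFrom q x), Sᶜ.image (fun q => M.evalFrom q x))) ∧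
      (bLang M p).Nonempty) ∧
    Set.InjOn (bLang M) (dPairs Q S.card (Fintype.card Q - S.card) : Set (Finset Q × Finset Q)) := by
  set D := dPairs Q S.card (Fintype.card Q - S.card) with hD
  set D' := D.filter (fun p => (∃ x : List A, p = (S.image (fun q => M.evalFrom q x),
    Sᶜ.image (fun q => M.evalFrom q x))) ∧ (bLang M p).Nonempty) with hD'
  let L : Quotient (rightCong (atom M (S : Set Q))) → Set (List A) :=
    Quotient.lift (fun x => {z | x ++ z ∈ atom M (S : Set Q)}) (fun x y h => Set.ext h)
  have hLinj : Function.Injective L := by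
    intro a b
    induction a using Quotient.inductionOn
    induction b using Quotient.inductionOn
    intro h
    exact Quotient.sound (fun z => Set.ext_iff.1 h z)
  have hrange : ∀ a, L a ∈ insert ∅ (D'.image (bLang M)) := by
    intro a
    induction a using Quotient.inductionOn with
    | h x =>
    set p := (S.image (fun q => M.evalFrom q x), Sᶜ.image (fun q => M.evalFrom q x)) with hp
    have hL : L ⟦x⟧ = bLang M p := by
      ext z
      change (∀ q, _ ↔ _) ↔ _
      simp only [bLang, hp, Set.mem_ofPred_eq, Finset.mem_image, Finset.mem_compl,
        DFA.evalFrom_of_append, Finset.mem_coe]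
      constructor
      · intro h
        constructor
        · rintro _ ⟨q, hq, rfl⟩
          exact (h q).2 hq
        · rintro _ ⟨q, hq, rfl⟩ h'
          exact hq ((h q).1 h')
      · rintro ⟨ha, hb⟩ q
        constructor
        · intro h
          by_contra hq
          exact hb _ ⟨q, hq, rfl⟩ h
        · intro hq
          exact ha _ ⟨q, hq, rfl⟩
    rw [Finset.mem_insert, Finset.mem_image, hL]
    by_cases hne : (bLang M p).Nonempty
    · right
      refine ⟨p, ?_, rfl⟩
      rw [hD', Finset.mem_filter]
      refine ⟨?_, ⟨x, rfl⟩, hne⟩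
      have hc : Sᶜ.card = Fintype.card Q - S.card := Finset.card_compl S
      simp only [hD, dPairs, Finset.mem_filter, Finset.mem_univ, true_and]
      refine ⟨?_, ⟨?_, Finset.card_image_le⟩, ?_, ?_⟩
      · obtain ⟨z, hz1, hz2⟩ := hne
        rw [Finset.disjoint_left]
        intro q hq1 hq2
        exact hz2 q hq2 (hz1 q hq1)
      · rw [Nat.one_le_iff_ne_zero, Finset.card_ne_zero, hp]
        exact (Finset.card_pos.1 h1).image _
      · rw [Nat.one_le_iff_ne_zero, Finset.card_ne_zero, hp]
        refine Finset.Nonempty.image (Finset.card_pos.1 ?_) _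
        omega
      · rw [← hc]
        exact Finset.card_image_le
    · left
      exact Set.not_nonempty_iff_eq_empty.1 hne
  have hcard : stateComplexity (atom M (S : Set Q)) ≤ (insert ∅ (D'.image (bLang M))).card := by
    unfold stateComplexity
    have := Nat.card_le_card_of_injective
      (fun a => (⟨L a, hrange a⟩ : {x // x ∈ insert ∅ (D'.image (bLang M))}))
      (fun a b h => hLinj (Subtype.ext_iff.1 h))
    exact this.trans (by rw [Nat.card_eq_fintype_card, Fintype.card_coe])
  have hPsi : D.card + 1 ≤ Psi (Fintype.card Q) S.card := by
    have := dPairs_card_le Q S.card (Fintype.card Q - S.card)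
    rw [← hD] at this
    unfold Psi
    rw [if_neg (by omega)]
    omega
  have hi1 := Finset.card_insert_le (∅ : Set (List A)) (D'.image (bLang M))
  have hi2 : (D'.image (bLang M)).card ≤ D'.card := Finset.card_image_le
  have hi3 : D'.card ≤ D.card := Finset.card_filter_le _ _
  have hDD : D' = D := Finset.eq_of_subset_of_card_le (Finset.filter_subset _ _) (by omega)
  refine ⟨fun p hp => ?_, ?_⟩
  · rw [← hDD, hD', Finset.mem_filter] at hp
    exact hp.2
  · rw [← hDD]
    exact Finset.card_image_iff.1 (by omega)

theorem statement8 {A Q : Type*} [Fintype A] [Fintype Q] (M : DFA A Q)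
    (n : ℕ) (hQ : Fintype.card Q = n) (hn : 3 ≤ n) (hmin : IsMinimal M)
    (hmax : ∀ S : Set Q, (atom M S).Nonempty →
      stateComplexity (atom M S) = Psi n S.ncard) :
    (∀ k : ℕ, 1 ≤ k → k ≤ n → ∀ X Y : Set Q, X.ncard = k → Y.ncard = k →
        ∃ w : List A, Function.Bijective (fun q => M.evalFrom q w) ∧
          (fun q => M.evalFrom q w) '' X = Y) ∧
    (∃ w : List A, w ≠ [] ∧ (Set.range (fun q => M.evalFrom q w)).ncard = n - 1) ∧
    (∀ T : Set Q, (atom M T).Nonempty) := by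
  classical
  subst hQ
  have hkey : ∀ S : Finset Q, 1 ≤ S.card → S.card + 1 ≤ Fintype.card Q →
      (atom M (S : Set Q)).Nonempty → _ := fun S h1 h2 h3 =>
    key M S h1 h2 (by rw [hmax _ h3, Set.ncard_coe_finset])
  have hmem : ∀ (s t : ℕ) (X Y : Finset Q), Disjoint X Y → 1 ≤ X.card → X.card ≤ s →
      1 ≤ Y.card → Y.card ≤ t → (X, Y) ∈ dPairs Q s t := by
    intro s t X Y h a b c d
    simp [dPairs, h, b, d]
    simp at a c
    exact ⟨a, c⟩
  -- same-size atoms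
  have hsame : ∀ S X : Finset Q, 1 ≤ S.card → S.card + 1 ≤ Fintype.card Q →
      (atom M (S : Set Q)).Nonempty → X.card = S.card → (atom M (X : Set Q)).Nonempty := by
    intro S X h1 h2 h3 hX
    have hc : Xᶜ.card = Fintype.card Q - X.card := Finset.card_compl X
    obtain ⟨_, z, hz1, hz2⟩ := (hkey S h1 h2 h3).1 (X, Xᶜ)
      (hmem _ _ _ _ disjoint_compl_right (by omega) (by omega) (by omega) (by omega))
    refine ⟨z, fun q => ⟨fun h => ?_, fun h => hz1 q h⟩⟩
    by_contra hq
    exact hz2 q (by simpa using hq) h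
  -- neighbours
  have hdiff : ∀ X Y : Finset Q, ∀ r : Q, r ∉ X → r ∉ Y → Disjoint X Y →
      (∀ q, q ∈ X ∨ q ∈ Y ∨ q = r) → bLang M (X, Y) ≠ bLang M (insert r X, Y) →
      (atom M (X : Set Q)).Nonempty := by
    intro X Y r hrX hrY hd hall hne
    by_contra hemp
    apply hne
    ext z
    constructor
    · rintro ⟨hz1, hz2⟩
      refine ⟨fun q hq => ?_, hz2⟩
      rcases Finset.mem_insert.1 hq with rfl | hq
      · by_contra hqa
        apply hemp
        refine ⟨z, fun q' => ⟨fun h => ?_, fun h => hz1 q' h⟩⟩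
        rcases hall q' with h' | h' | h'
        · exact h'
        · exact absurd h (hz2 _ h')
        · subst h'; exact absurd h hqa
      · exact hz1 q hq
    · rintro ⟨hz1, hz2⟩
      exact ⟨fun q hq => hz1 q (Finset.mem_insert_of_mem hq), hz2⟩
  have hdiff' : ∀ X Y : Finset Q, ∀ r : Q, r ∉ X → r ∉ Y → Disjoint X Y →
      (∀ q, q ∈ X ∨ q ∈ Y ∨ q = r) → bLang M (X, Y) ≠ bLang M (X, insert r Y) →
      (atom M ((insert r X : Finset Q) : Set Q)).Nonempty := by
    intro X Y r hrX hrY hd hall hne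
    by_contra hemp
    apply hne
    ext z
    constructor
    · rintro ⟨hz1, hz2⟩
      refine ⟨hz1, fun q hq => ?_⟩
      rcases Finset.mem_insert.1 hq with rfl | hq
      · intro hqa
        apply hemp
        refine ⟨z, fun q' => ⟨fun h => ?_, fun h => ?_⟩⟩
        · rcases hall q' with h' | h' | h'
          · simp [h']
          · exact absurd h (hz2 _ h')
          · simp [h']
        · rcases Finset.mem_insert.1 (Finset.mem_coe.1 h) with rfl | h'
          · exact hqa
          · exact hz1 _ h'
      · exact hz2 q hq
    · rintro ⟨hz1, hz2⟩
      exact ⟨hz1, fun q hq => hz2 q (Finset.mem_insert_of_mem hq)⟩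
  let I : ℕ → Prop := fun s => ∀ X : Finset Q, X.card = s → (atom M (X : Set Q)).Nonempty
  have hex : ∀ s, s ≤ Fintype.card Q → ∃ X : Finset Q, X.card = s := fun s hs => by
    obtain ⟨X, _, hX⟩ := Finset.exists_subset_card_eq (s := (Finset.univ : Finset Q)) (n := s)
      (by simpa using hs)
    exact ⟨X, hX⟩
  have hdown : ∀ s, 1 ≤ s → s + 2 ≤ Fintype.card Q → I (s + 1) → I s := by
    intro s h1 h2 hI X hX
    have hc : Xᶜ.card = Fintype.card Q - X.card := Finset.card_compl X
    obtain ⟨r, hr⟩ : Xᶜ.Nonempty := Finset.card_pos.1 (by omega)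
    have hrX : r ∉ X := by simpa using hr
    have hcI : (insert r X).card = s + 1 := by rw [Finset.card_insert_of_notMem hrX, hX]
    have hcE : (Xᶜ.erase r).card = Fintype.card Q - s - 1 := by
      rw [Finset.card_erase_of_mem hr]; omega
    have hdj : Disjoint (insert r X) (Xᶜ.erase r) := by
      rw [Finset.disjoint_left]; intro q; simp; tauto
    have hdj' : Disjoint X (Xᶜ.erase r) := hdj.mono_left (Finset.subset_insert _ _)
    refine hdiff X (Xᶜ.erase r) r hrX (by simp) hdj' (fun q => by simp; tauto) fun he => ?_
    have := (hkey (insert r X) (by omega) (by omega) (hI _ hcI)).2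
      (hmem _ _ X (Xᶜ.erase r) hdj' (by omega) (by omega) (by omega) (by omega))
      (hmem _ _ (insert r X) (Xᶜ.erase r) hdj (by omega) (by omega) (by omega) (by omega)) he
    have h3 := congrArg (fun p => p.1.card) this
    simp only at h3
    omega
  have hup : ∀ s, 1 ≤ s → s + 2 ≤ Fintype.card Q → I s → I (s + 1) := by
    intro s h1 h2 hI Z hZ
    obtain ⟨r, hr⟩ : Z.Nonempty := Finset.card_pos.1 (by omega)
    have hc : Zᶜ.card = Fintype.card Q - Z.card := Finset.card_compl Z
    have hcX : (Z.erase r).card = s := by rw [Finset.card_erase_of_mem hr]; omega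
    have hcI : (insert r Zᶜ).card = Fintype.card Q - s := by
      rw [Finset.card_insert_of_notMem (by simpa using hr)]; omega
    have hdj : Disjoint (Z.erase r) (insert r Zᶜ) := by
      rw [Finset.disjoint_left]; intro q; simp +contextual
    have hdj' : Disjoint (Z.erase r) Zᶜ := hdj.mono_right (Finset.subset_insert _ _)
    rw [← Finset.insert_erase hr]
    refine hdiff' (Z.erase r) Zᶜ r (by simp) (by simpa using hr) hdj'
      (fun q => by simp; tauto) fun he => ?_
    have := (hkey (Z.erase r) (by omega) (by omega) (hI _ hcX)).2
      (hmem _ _ (Z.erase r) Zᶜ hdj' (by omega) (by omega) (by omega) (by omega))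
      (hmem _ _ (Z.erase r) (insert r Zᶜ) hdj (by omega) (by omega) (by omega) (by omega)) he
    have h3 := congrArg (fun p => p.2.card) this
    simp only at h3
    omega
  obtain ⟨s₀, hs1, hs2, hI0⟩ : ∃ s, 1 ≤ s ∧ s + 1 ≤ Fintype.card Q ∧ I s := by
    obtain ⟨p, q, hpq⟩ := Fintype.exists_pair_of_one_lt_card (show 1 < Fintype.card Q by omega)
    obtain ⟨w, hw⟩ := hmin.2 p q hpq
    set S : Finset Q := Finset.univ.filter (fun q => M.evalFrom q w ∈ M.accept) with hS
    have hSne : (atom M (S : Set Q)).Nonempty := ⟨w, fun q => by simp [hS]⟩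
    have ha : 1 ≤ S.card := by
      by_contra h
      have : S = ∅ := Finset.card_eq_zero.1 (by omega)
      have hp : p ∉ S := by simp [this]
      have hq : q ∉ S := by simp [this]
      simp [hS] at hp hq
      tauto
    have hb : S.card + 1 ≤ Fintype.card Q := by
      by_contra h
      have : S = Finset.univ := Finset.eq_univ_of_card S
        (le_antisymm (Finset.card_le_univ S) (by omega))
      have hp : p ∈ S := by simp [this]
      have hq : q ∈ S := by simp [this]
      simp [hS] at hp hq
      tauto
    exact ⟨S.card, ha, hb, fun X hX => hsame S X ha hb hSne hX⟩
  have hI1 : I 1 := by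
    have : ∀ s, 1 ≤ s → s + 1 ≤ Fintype.card Q → I s → I 1 := by
      intro s hs
      induction s, hs using Nat.le_induction with
      | base => exact fun _ h => h
      | succ m hm ih => exact fun h1 h2 => ih (by omega) (hdown m hm (by omega) h2)
    exact this s₀ hs1 hs2 hI0
  have hIall : ∀ s, 1 ≤ s → s + 1 ≤ Fintype.card Q → I s := by
    intro s hs
    induction s, hs using Nat.le_induction with
    | base => exact fun _ => hI1
    | succ m hm ih => exact fun h1 => hup m hm (by omega) (ih (by omega))
  -- rank n-1
  obtain ⟨g, p, hg⟩ : ∃ (g : List A) (p : Q), Set.range (fun q => M.evalFrom q g) = {p}ᶜ := by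
    obtain ⟨S, hS⟩ := hex 2 (by omega)
    obtain ⟨X, hX⟩ := hex 2 (by omega)
    obtain ⟨a, b, hab, rfl⟩ := Finset.card_eq_two.1 hX
    have hc : ({a, b}ᶜ : Finset Q).card = Fintype.card Q - 2 := by rw [Finset.card_compl, hX]
    obtain ⟨⟨x, hx⟩, _⟩ := (hkey S (by omega) (by omega) (hIall 2 (by omega) (by omega) S hS)).1
      ({a}, {a, b}ᶜ) (hmem _ _ _ _ (by simp) (by simp) (by rw [Finset.card_singleton]; omega) (by omega) (by omega))
    rw [Prod.mk.injEq] at hx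
    refine ⟨x, b, ?_⟩
    have h1 : Set.range (fun q => M.evalFrom q x) =
        ((Finset.univ.image (fun q => M.evalFrom q x) : Finset Q) : Set Q) := by simp
    rw [h1, ← Finset.union_compl S, Finset.image_union, ← hx.1, ← hx.2]
    ext q
    simp
    by_cases h : q = a
    · subst h; simp [hab]
    · simp [h]
  have hcp : ({p}ᶜ : Finset Q).card = Fintype.card Q - 1 := by simp [Finset.card_compl]
  refine ⟨?_, ⟨g, ?_, ?_⟩, ?_⟩
  · intro k hk1 hk2 X Y hX hY
    rcases Nat.lt_or_ge k (Fintype.card Q) with hlt | hge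
    · have hX' : X.toFinset.card = k := by rw [← Set.ncard_eq_toFinset_card', hX]
      have hY' : Y.toFinset.card = k := by rw [← Set.ncard_eq_toFinset_card', hY]
      have hc : (Y.toFinsetᶜ : Finset Q).card = Fintype.card Q - Y.toFinset.card :=
        Finset.card_compl _
      obtain ⟨⟨x, hx⟩, _⟩ := (hkey X.toFinset (by omega) (by omega)
        (hIall k hk1 (by omega) _ hX')).1 (Y.toFinset, Y.toFinsetᶜ)
        (hmem _ _ _ _ disjoint_compl_right (by omega) (by omega) (by omega) (by omega))
      rw [Prod.mk.injEq] at hx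
      refine ⟨x, ?_, ?_⟩
      · apply Finite.surjective_iff_bijective.1
        intro q
        by_cases hq : q ∈ Y.toFinset
        · rw [hx.1] at hq
          obtain ⟨a, _, ha⟩ := Finset.mem_image.1 hq
          exact ⟨a, ha⟩
        · rw [← Finset.mem_compl, hx.2] at hq
          obtain ⟨a, _, ha⟩ := Finset.mem_image.1 hq
          exact ⟨a, ha⟩
      · have := congrArg (fun s : Finset Q => (s : Set Q)) hx.1
        simpa using this.symm
    · have hu : ∀ Z : Set Q, Z.ncard = k → Z = Set.univ := fun Z hZ => by
        apply (Set.eq_univ_iff_ncard Z).2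
        rw [hZ, Nat.card_eq_fintype_card]; omega
      refine ⟨[], ?_, ?_⟩
      · exact Function.bijective_id
      · rw [hu X hX, hu Y hY]
        exact Set.image_id _
  · rintro rfl
    have : p ∈ Set.range (fun q => M.evalFrom q []) := ⟨p, rfl⟩
    rw [hg] at this
    exact this rfl
  · rw [hg]
    have : ({p}ᶜ : Set Q) = (({p}ᶜ : Finset Q) : Set Q) := by simp
    rw [this, Set.ncard_coe_finset, hcp]
  · have hgp : ∀ q, M.evalFrom q g ≠ p := by
      intro q
      have : M.evalFrom q g ∈ Set.range (fun q => M.evalFrom q g) := ⟨q, rfl⟩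
      rw [hg] at this
      exact this
    intro T
    have hT : (T.toFinset : Set Q) = T := by simp
    have hle : T.toFinset.card ≤ Fintype.card Q := Finset.card_le_univ _
    by_cases h0 : T.toFinset.card = 0
    · have hTe : T = ∅ := by rw [← hT, Finset.card_eq_zero.1 h0]; simp
      obtain ⟨f, hf⟩ := hI1 {p} (by simp)
      refine ⟨g ++ f, fun q => ?_⟩
      rw [DFA.evalFrom_of_append, hf, hTe]
      simp [hgp]
    by_cases h1 : T.toFinset.card = Fintype.card Q
    · have hTe : T = Set.univ := by rw [← hT, (Finset.card_eq_iff_eq_univ _).1 h1]; simp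
      obtain ⟨f, hf⟩ := hIall (Fintype.card Q - 1) (by omega) (by omega) {p}ᶜ hcp
      refine ⟨g ++ f, fun q => ?_⟩
      rw [DFA.evalFrom_of_append, hf, hTe]
      simp [hgp]
    · rw [← hT]
      exact hIall _ (by omega) (by omega) _ rfl
end
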